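/- If u is a λ-eigenfunction of −Δ on K, then the function v : ℝ/ℤ → ℝ defined by v(t) = u(5t) is admissible and is a 15λ-eigenfunction of −Δ on K. -/

import Mathlib

open scoped BigOperators

noncomputable section

namespace VNLE

/-- `N_m = 2·5^m`, the number of points on the circle at level `m`. -/
def Nm (m : ℕ) : ℕ := 2 * 5 ^ m

/-- The partner of a vertex `n` of `K_m`: writing the representative `v` of `n`
(taking `v = 2·5^m` when `n = 0`) as `v = 5^k·a` with `5 ∤ a`, the partner is
`n + 5^k` if `a ≡ 1` or `3 (mod 5)`, and `n - 5^k` if `a ≡ 2` or `4 (mod 5)`.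
This realizes the identifications `5^k(1+5j) ∼ 5^k(2+5j)` and
`5^k(3+5j) ∼ 5^k(4+5j)` in `ℤ/(2·5^m)ℤ`. -/
def partner (m : ℕ) (n : ZMod (Nm m)) : ZMod (Nm m) :=
  let v : ℕ := if n.val = 0 then Nm m else n.val
  let k : ℕ := padicValNat 5 v
  if (v / 5 ^ k) % 5 = 1 ∨ (v / 5 ^ k) % 5 = 3 then n + ((5 ^ k : ℕ) : ZMod (Nm m))
  else n - ((5 ^ k : ℕ) : ZMod (Nm m))

/-- A function on `K_m`: a map on `ℤ/N_mℤ` constant on the identified pairs. -/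
def IsKFun (m : ℕ) (u : ZMod (Nm m) → ℝ) : Prop := ∀ n, u (partner m n) = u n

/-- The graph Laplacian `−Δ_m`. -/
def lap (m : ℕ) (u : ZMod (Nm m) → ℝ) : ZMod (Nm m) → ℝ := fun n =>
  4 * u n - u (n + 1) - u (n - 1) - u (partner m n + 1) - u (partner m n - 1)

/-- `u` is a `λ`-eigenfunction of `−Δ_m`. -/
def IsEigen (m : ℕ) (lam : ℝ) (u : ZMod (Nm m) → ℝ) : Prop :=
  IsKFun m u ∧ u ≠ 0 ∧ ∀ n, lap m u n = lam * u n

/-- The spectral decimation renormalization polynomial `R(x) = x(3−x)(5−x)`. -/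
def R (x : ℝ) : ℝ := x * (3 - x) * (5 - x)

/-- The `λ'`-extension of a function on `K_m` to a function on `K_{m+1}`. -/
def extFun (m : ℕ) (lam' : ℝ) (u : ZMod (Nm m) → ℝ) : ZMod (Nm (m + 1)) → ℝ := fun x =>
  let n : ZMod (Nm m) := ((x.val / 5 : ℕ) : ZMod (Nm m))
  if x.val % 5 = 0 then u n
  else if x.val % 5 = 1 ∨ x.val % 5 = 2 then
    ((2 - lam') * u n + u (n + 1)) / ((1 - lam') * (3 - lam'))
  else
    (u n + (2 - lam') * u (n + 1)) / ((1 - lam') * (3 - lam'))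

/-- Restriction of a function on `K_{m+1}` to the old vertices, giving a function on `K_m`. -/
def down (m : ℕ) (v : ZMod (Nm (m + 1)) → ℝ) : ZMod (Nm m) → ℝ := fun n =>
  v (((5 * n.val : ℕ) : ZMod (Nm (m + 1))))

/-- The Laplacian `−Δ_m` as a linear map. -/
def lapL (m : ℕ) : (ZMod (Nm m) → ℝ) →ₗ[ℝ] (ZMod (Nm m) → ℝ) where
  toFun := lap m
  map_add' u v := by funext n; simp only [lap, Pi.add_apply]; ring
  map_smul' c u := by funext n; simp only [lap, Pi.smul_apply, smul_eq_mul, RingHom.id_apply]; ring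

/-- The subspace of functions on `K_m` (maps constant on identified pairs). -/
def KFunSub (m : ℕ) : Submodule ℝ (ZMod (Nm m) → ℝ) where
  carrier := {u | IsKFun m u}
  add_mem' := by
    intro u v hu hv n
    simp only [Pi.add_apply, hu n, hv n]
  zero_mem' := fun _ => rfl
  smul_mem' := by
    intro c u hu n
    simp only [Pi.smul_apply, hu n]

/-- The `λ`-eigenspace of `−Δ_m` inside the space of functions on `K_m`. -/
def eigensp (m : ℕ) (lam : ℝ) : Submodule ℝ (ZMod (Nm m) → ℝ) :=
  LinearMap.ker (lapL m - lam • LinearMap.id) ⊓ KFunSub m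

/-- `c = (8 − √19)/3`, the smaller critical point of `R`. -/
def cpt : ℝ := (8 - Real.sqrt 19) / 3

/-- `φ₁`, the inverse of the (strictly increasing) restriction of `R` to `[0, c]`. -/
def phi1 : ℝ → ℝ := Function.invFunOn R (Set.Icc 0 cpt)

/-- Eigenvalue counting function: total dimension of the eigenspaces of `−Δ_m`
with eigenvalue `≤ t`. -/
def evCount (m : ℕ) (t : ℝ) : ℕ :=
  Module.finrank ℝ ↥(⨆ lam ∈ Set.Iic t, eigensp m lam)

/-- `evSorted m k = λ_k(m)`, the `k`-th smallest eigenvalue (with multiplicity,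
`1 ≤ k ≤ 5^m`) of `−Δ_m` acting on functions on `K_m`. -/
def evSorted (m k : ℕ) : ℝ := sInf {t : ℝ | k ≤ evCount m t}

/-- The restriction of a function on the circle `ℝ/ℤ` to the level-`m` vertices. -/
def restr (u : AddCircle (1 : ℝ) → ℝ) (m : ℕ) : ZMod (Nm m) → ℝ := fun n =>
  u (((n.val : ℝ) / (Nm m : ℝ) : ℝ) : AddCircle (1 : ℝ))

/-- A continuous function on the circle is admissible if at every level its values
agree on identified pairs, so that its restrictions are functions on `K_m`. -/
def Admissible (u : AddCircle (1 : ℝ) → ℝ) : Prop :=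
  Continuous u ∧ ∀ m, 1 ≤ m → ∀ n : ZMod (Nm m), restr u m (partner m n) = restr u m n

/-- `u` is a `λ`-eigenfunction of `−Δ` on `K`: it is admissible, nonzero, and
`sup_n |15^m (−Δ_m u_m)(n) − λ u(n/N_m)| → 0` as `m → ∞`. -/
def IsEigenK (lam : ℝ) (u : AddCircle (1 : ℝ) → ℝ) : Prop :=
  Admissible u ∧ u ≠ 0 ∧
    ∀ ε : ℝ, 0 < ε → ∃ M : ℕ, ∀ m, M ≤ m → ∀ n : ZMod (Nm m),
      |(15 : ℝ) ^ m * lap m (restr u m) n - lam * restr u m n| < ε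

/-- The symmetry-type subspace `V_{ε₁,ε₂}` of functions on `K_m`. -/
def symSub (m : ℕ) (e1 e2 : ℝ) : Submodule ℝ (ZMod (Nm m) → ℝ) where
  carrier := {u | IsKFun m u ∧ (∀ n, u (-n) = e1 * u n) ∧
    (∀ n, u (((5 ^ m : ℕ) : ZMod (Nm m)) - n) = e2 * u n)}
  add_mem' := by
    rintro u v ⟨hu, hu1, hu2⟩ ⟨hv, hv1, hv2⟩
    refine ⟨fun n => by simp only [Pi.add_apply, hu n, hv n],
      fun n => by simp only [Pi.add_apply, hu1 n, hv1 n]; ring,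
      fun n => by simp only [Pi.add_apply, hu2 n, hv2 n]; ring⟩
  zero_mem' := ⟨fun _ => rfl, fun n => by simp, fun n => by simp⟩
  smul_mem' := by
    rintro c u ⟨hu, hu1, hu2⟩
    refine ⟨fun n => by simp only [Pi.smul_apply, hu n],
      fun n => by simp only [Pi.smul_apply, smul_eq_mul, hu1 n]; ring,
      fun n => by simp only [Pi.smul_apply, smul_eq_mul, hu2 n]; ring⟩

instance neZero_Nm (m : ℕ) : NeZero (Nm m) := ⟨by unfold Nm; positivity⟩

theorem Nm_succ (m : ℕ) : Nm (m + 1) = 5 * Nm m := by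
  unfold Nm; ring

theorem Nm_dvd_succ (m : ℕ) : Nm m ∣ Nm (m + 1) := ⟨5, by rw [Nm_succ, mul_comm]⟩

/-- The reduction `ℤ/N_{m+1}ℤ → ℤ/N_mℤ`. -/
def reduce (m : ℕ) : ZMod (Nm (m + 1)) →+* ZMod (Nm m) :=
  ZMod.castHom (Nm_dvd_succ m) (ZMod (Nm m))

theorem padicValNat_five_pow_mul (k b : ℕ) (hb : b % 5 ≠ 0) : padicValNat 5 (5 ^ k * b) = k := by
  have : Fact (Nat.Prime 5) := ⟨by norm_num⟩
  have hb0 : b ≠ 0 := by rintro rfl; simp at hb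
  rw [padicValNat.mul (by positivity) hb0, padicValNat.prime_pow,
    padicValNat.eq_zero_of_not_dvd (fun h => hb (Nat.mod_eq_zero_of_dvd h)), add_zero]

/-- The partner of `n` is determined by any factorisation `5^k·b`, `5 ∤ b`, of its
representative in `{1, …, N_m}`. -/
theorem partner_of_rep (m : ℕ) (n : ZMod (Nm m)) (k b : ℕ) (hb : b % 5 ≠ 0)
    (h : (if n.val = 0 then Nm m else n.val) = 5 ^ k * b) :
    partner m n = if b % 5 = 1 ∨ b % 5 = 3 then n + ((5 ^ k : ℕ) : ZMod (Nm m))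
      else n - ((5 ^ k : ℕ) : ZMod (Nm m)) := by
  simp only [partner, h, padicValNat_five_pow_mul k b hb,
    Nat.mul_div_cancel_left b (show 0 < 5 ^ k by positivity)]

theorem partner_natCast_of_lt (m k a : ℕ) (hk : k < m) (ha : a % 5 ≠ 0) :
    partner m ((5 ^ k * a : ℕ) : ZMod (Nm m)) =
      if a % 5 = 1 ∨ a % 5 = 3 then
        ((5 ^ k * a : ℕ) : ZMod (Nm m)) + ((5 ^ k : ℕ) : ZMod (Nm m))
      else ((5 ^ k * a : ℕ) : ZMod (Nm m)) - ((5 ^ k : ℕ) : ZMod (Nm m)) := by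
  obtain ⟨d, rfl⟩ := Nat.exists_eq_add_of_lt hk
  have hN : Nm (k + d + 1) = 5 ^ k * (2 * 5 ^ (d + 1)) := by unfold Nm; ring
  have hval : ((5 ^ k * a : ℕ) : ZMod (Nm (k + d + 1))).val
      = 5 ^ k * (a % (2 * 5 ^ (d + 1))) := by
    rw [ZMod.val_natCast, ← Nat.mul_mod_mul_left, ← hN]
  have hmod : a % (2 * 5 ^ (d + 1)) % 5 = a % 5 :=
    Nat.mod_mod_of_dvd _ ⟨2 * 5 ^ d, by ring⟩
  have hne : 5 ^ k * (a % (2 * 5 ^ (d + 1))) ≠ 0 := by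
    refine mul_ne_zero (by positivity) fun h0 => ha ?_
    rw [← hmod, h0, Nat.zero_mod]
  rw [partner_of_rep _ _ k (a % (2 * 5 ^ (d + 1))) (by rwa [hmod]) (by rw [hval, if_neg hne]), hmod]

theorem two_mul_five_pow_eq_zero (m : ℕ) : (2 : ZMod (Nm m)) * 5 ^ m = 0 := by
  have h : ((Nm m : ℕ) : ZMod (Nm m)) = 0 := ZMod.natCast_self _
  have h' : ((2 * 5 ^ m : ℕ) : ZMod (Nm m)) = 0 := h
  exact_mod_cast h'

theorem partner_five_pow_mul (m a : ℕ) :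
    partner m ((5 ^ m * a : ℕ) : ZMod (Nm m)) =
      ((5 ^ m * a : ℕ) : ZMod (Nm m)) + ((5 ^ m : ℕ) : ZMod (Nm m)) := by
  have hval : ((5 ^ m * a : ℕ) : ZMod (Nm m)).val = 5 ^ m * (a % 2) := by
    rw [ZMod.val_natCast, ← Nat.mul_mod_mul_left]
    simp [Nm, mul_comm]
  rcases Nat.mod_two_eq_zero_or_one a with h | h
  · rw [partner_of_rep m _ m 2 (by norm_num) (by rw [hval, h]; simp [Nm, mul_comm]),
      if_neg (by norm_num)]
    push_cast
    linear_combination -two_mul_five_pow_eq_zero m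
  · rw [partner_of_rep m _ m 1 (by norm_num) (by rw [hval, h]; simp), if_pos (by norm_num)]

theorem reduce_partner (m : ℕ) (n : ZMod (Nm (m + 1))) :
    reduce m (partner (m + 1) n) = partner m (reduce m n) := by
  have h2 := two_mul_five_pow_eq_zero m
  have hmul : ∀ a : ℕ, reduce m (partner (m + 1) ((5 ^ (m + 1) * a : ℕ) : ZMod (Nm (m + 1))))
      = partner m (reduce m ((5 ^ (m + 1) * a : ℕ) : ZMod (Nm (m + 1)))) := by
    intro a
    rw [partner_five_pow_mul, map_add, map_natCast, map_natCast,
      show 5 ^ (m + 1) * a = 5 ^ m * (5 * a) by ring, partner_five_pow_mul]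
    push_cast
    linear_combination 2 * h2
  rw [← ZMod.natCast_zmod_val n]
  generalize n.val = v
  rcases Nat.eq_zero_or_pos v with rfl | hv
  · simpa using hmul 0
  obtain ⟨k, a, ha, rfl⟩ := Nat.exists_eq_pow_mul_and_not_dvd hv.ne' 5 (by norm_num)
  have ha' : a % 5 ≠ 0 := fun h => ha (Nat.dvd_of_mod_eq_zero h)
  rcases lt_trichotomy k m with hk | rfl | hk
  · rw [map_natCast, partner_natCast_of_lt _ _ _ (hk.trans m.lt_succ_self) ha',
      partner_natCast_of_lt _ _ _ hk ha']
    split_ifs <;> simp only [map_add, map_sub, map_natCast]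
  · rw [map_natCast, partner_natCast_of_lt _ _ _ k.lt_succ_self ha', partner_five_pow_mul]
    split_ifs
    · simp only [map_add, map_natCast]
    · simp only [map_sub, map_natCast]
      push_cast
      linear_combination -h2
  · obtain ⟨d, rfl⟩ := Nat.exists_eq_add_of_lt hk
    rw [show 5 ^ (m + d + 1) * a = 5 ^ (m + 1) * (5 ^ d * a) by ring]
    exact hmul _

theorem restr_natCast (u : AddCircle (1 : ℝ) → ℝ) (m v : ℕ) :
    restr u m (v : ZMod (Nm m)) = u (((v : ℝ) / (Nm m : ℝ) : ℝ) : AddCircle (1 : ℝ)) := by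
  have hN : (Nm m : ℝ) ≠ 0 := Nat.cast_ne_zero.mpr (NeZero.ne _)
  unfold restr
  rw [ZMod.val_natCast]
  congr 1
  have h : (v : ℝ) = (v % Nm m : ℕ) + (Nm m : ℝ) * (v / Nm m : ℕ) := by
    exact_mod_cast (Nat.mod_add_div v (Nm m)).symm
  have h' : (v : ℝ) / (Nm m : ℝ)
      = ((v % Nm m : ℕ) : ℝ) / (Nm m : ℝ) + (v / Nm m : ℕ) • (1 : ℝ) := by
    rw [nsmul_one]
    field_simp
    linarith
  rw [h', AddCircle.coe_add, AddCircle.coe_nsmul, AddCircle.coe_period, smul_zero, add_zero]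

theorem restr_five_nsmul (u : AddCircle (1 : ℝ) → ℝ) (m : ℕ) (n : ZMod (Nm (m + 1))) :
    restr (fun t => u ((5 : ℕ) • t)) (m + 1) n = restr u m (reduce m n) := by
  rw [← ZMod.natCast_zmod_val n, map_natCast, restr_natCast, restr_natCast]
  have hN : (Nm m : ℝ) ≠ 0 := Nat.cast_ne_zero.mpr (NeZero.ne _)
  rw [← AddCircle.coe_nsmul]
  congr 2
  have h5 : (Nm (m + 1) : ℝ) = 5 * Nm m := by exact_mod_cast Nm_succ m
  rw [h5, nsmul_eq_mul]
  push_cast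
  field_simp

/-- An admissible function also agrees on identified pairs at level `0`. -/
theorem Admissible.restr_partner {u : AddCircle (1 : ℝ) → ℝ} (hu : Admissible u) (m : ℕ)
    (n : ZMod (Nm m)) : restr u m (partner m n) = restr u m n := by
  rcases Nat.eq_zero_or_pos m with rfl | hm
  swap
  · exact hu.2 m hm n
  have hcast : ∀ v : ℕ, restr u 0 (v : ZMod (Nm 0)) = restr u 1 ((5 ^ 1 * v : ℕ) : ZMod (Nm 1)) := by
    intro v
    rw [restr_natCast, restr_natCast]
    congr 2
    simp only [Nm]
    push_cast
    ring
  rw [← ZMod.natCast_zmod_val n]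
  generalize n.val = v
  have h0 := partner_five_pow_mul 0 v
  rw [pow_zero, one_mul, ← Nat.cast_add] at h0
  have h1 := partner_five_pow_mul 1 v
  rw [← Nat.cast_add, show 5 ^ 1 * v + 5 ^ 1 = 5 ^ 1 * (v + 1) by ring] at h1
  rw [h0, hcast, hcast, ← h1]
  exact hu.2 1 le_rfl _

theorem lap_restr_five_nsmul (u : AddCircle (1 : ℝ) → ℝ) (m : ℕ) (n : ZMod (Nm (m + 1))) :
    lap (m + 1) (restr (fun t => u ((5 : ℕ) • t)) (m + 1)) n
      = lap m (restr u m) (reduce m n) := by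
  simp only [lap, restr_five_nsmul, map_add, map_sub, map_one, reduce_partner]

theorem Admissible.comp_five_nsmul {u : AddCircle (1 : ℝ) → ℝ} (hu : Admissible u) :
    Admissible (fun t => u ((5 : ℕ) • t)) := by
  refine ⟨hu.1.comp (continuous_nsmul 5), fun m hm n => ?_⟩
  obtain ⟨m, rfl⟩ := Nat.exists_eq_add_of_le' hm
  rw [restr_five_nsmul, restr_five_nsmul, reduce_partner, hu.restr_partner]

/-- If `u` is a `λ`-eigenfunction of `−Δ` on `K`, then `v(t) = u(5t)`
is admissible and is a `15λ`-eigenfunction of `−Δ` on `K` (miniaturization). -/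
theorem miniaturization (lam : ℝ) (u : AddCircle (1 : ℝ) → ℝ) (hu : IsEigenK lam u) :
    Admissible (fun t => u ((5 : ℕ) • t)) ∧
    IsEigenK (15 * lam) (fun t => u ((5 : ℕ) • t)) := by
  obtain ⟨hadm, hne, hlim⟩ := hu
  refine ⟨hadm.comp_five_nsmul, hadm.comp_five_nsmul, fun h0 => hne ?_, fun ε hε => ?_⟩
  · funext t
    induction t using QuotientAddGroup.induction_on with
    | H x =>
      have h := congrFun h0 ((x / 5 : ℝ) : AddCircle (1 : ℝ))
      simp only [← AddCircle.coe_nsmul, nsmul_eq_mul, Nat.cast_ofNat, Pi.zero_apply] at h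
      rwa [mul_div_cancel₀ x (by norm_num : (5 : ℝ) ≠ 0)] at h
  · obtain ⟨M, hM⟩ := hlim (ε / 15) (by positivity)
    refine ⟨M + 1, fun m hm n => ?_⟩
    obtain ⟨m, rfl⟩ := Nat.exists_eq_add_of_le' (le_trans (Nat.le_add_left 1 M) hm)
    have h := hM m (by omega) (reduce m n)
    rw [lap_restr_five_nsmul, restr_five_nsmul,
      show ∀ a b : ℝ, (15 : ℝ) ^ (m + 1) * a - 15 * lam * b = 15 * ((15 : ℝ) ^ m * a - lam * b)
        from fun a b => by ring, abs_mul, abs_of_pos (by norm_num : (0 : ℝ) < 15)]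
    linarith

end VNLE
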